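/- If the capacities u are integral (u(a) ∈ ℤ≥0 for all a ∈ A), then there exists a half-integral strictly reroutable s-t-flow x such that val(x) ≥ val(y)/2 for every reroutable s-t-flow y. -/

import Mathlib

open scoped BigOperators

variable {V A : Type}

/-- `IsWalk tl hd v w L`: the list of arcs `L` forms a walk from `v` to `w`
in the digraph whose arcs `a` go from `tl a` to `hd a`. -/
def IsWalk (tl hd : A → V) : V → V → List A → Prop
  | v, w, [] => v = w
  | v, w, a :: L => tl a = v ∧ IsWalk tl hd (hd a) w L

/-- A simple path from `v` to `w`: a walk visiting no vertex twice. -/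
def IsPath (tl hd : A → V) (v w : V) (L : List A) : Prop :=
  IsWalk tl hd v w L ∧ (v :: L.map hd).Nodup

/-- `Before L b a`: the list `L` traverses `b` (strictly) before `a`. -/
def Before (L : List A) (b a : A) : Prop :=
  ∃ l₁ l₂ l₃ : List A, L = l₁ ++ b :: (l₂ ++ a :: l₃)

/-- Sum of a path-flow over a set of paths. -/
noncomputable def sumOver (x : List A → ℝ) (S : Set (List A)) : ℝ :=
  ∑ᶠ P ∈ S, x P

/-- Flow value `x(a)` on an arc `a`: total flow on `s`-`t`-paths through `a`. -/
noncomputable def arcFlow (tl hd : A → V) (s t : V) (x : List A → ℝ) (a : A) : ℝ :=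
  sumOver x {P | IsPath tl hd s t P ∧ a ∈ P}

/-- The value of a flow: total flow on all `s`-`t`-paths. -/
noncomputable def flowVal (tl hd : A → V) (s t : V) (x : List A → ℝ) : ℝ :=
  sumOver x {P | IsPath tl hd s t P}

/-- An `s`-`t`-(path-)flow: nonnegative, supported on simple `s`-`t`-paths,
respecting the arc capacities `u`. -/
def IsFlow (tl hd : A → V) (s t : V) (u : A → ℝ) (x : List A → ℝ) : Prop :=
  (∀ P, 0 ≤ x P) ∧ (∀ P, ¬ IsPath tl hd s t P → x P = 0) ∧
    ∀ a : A, arcFlow tl hd s t x a ≤ u a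

/-- Available capacity `ū_{x,b}(a)` of arc `a` after failure of arc `b`:
`u(a)` minus the flow on paths through `a` that do not traverse `b` before `a`. -/
noncomputable def availCap (tl hd : A → V) (s t : V) (u : A → ℝ) (x : List A → ℝ)
    (b a : A) : ℝ :=
  u a - sumOver x {P | IsPath tl hd s t P ∧ a ∈ P ∧ ¬ Before P b a}

/-- Arc flow of a rerouting flow `y` for failing arc `b`: `y` lives on
`tl b`-`t`-paths avoiding `b`. -/
noncomputable def reArcFlow (tl hd : A → V) (t : V) (b : A) (y : List A → ℝ) (a : A) : ℝ :=
  sumOver y {Q | IsPath tl hd (tl b) t Q ∧ b ∉ Q ∧ a ∈ Q}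

/-- Value of a rerouting flow `y` for failing arc `b`. -/
noncomputable def reVal (tl hd : A → V) (t : V) (b : A) (y : List A → ℝ) : ℝ :=
  sumOver y {Q | IsPath tl hd (tl b) t Q ∧ b ∉ Q}

/-- `y` is a rerouting of `x` for the failing arc `b`: a `tl b`-`t`-flow of value
`x(b)` in `(V, A ∖ {b})` with capacities `ū_{x,b}`. -/
def IsRerouting (tl hd : A → V) (s t : V) (u : A → ℝ) (x : List A → ℝ) (b : A)
    (y : List A → ℝ) : Prop :=
  (∀ Q, 0 ≤ y Q) ∧
  (∀ Q, ¬ (IsPath tl hd (tl b) t Q ∧ b ∉ Q) → y Q = 0) ∧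
  (∀ a : A, a ≠ b → reArcFlow tl hd t b y a ≤ availCap tl hd s t u x b a) ∧
  reVal tl hd t b y = arcFlow tl hd s t x b

/-- `y` is a strict rerouting of `x` for the failing arc `b`: a `tl b`-`t`-flow
of value `x(b)` in `(V, A ∖ {b})` with `y(a) ≤ u(a) - x(a)` for all `a ≠ b`. -/
def IsStrictRerouting (tl hd : A → V) (s t : V) (u : A → ℝ) (x : List A → ℝ) (b : A)
    (y : List A → ℝ) : Prop :=
  (∀ Q, 0 ≤ y Q) ∧
  (∀ Q, ¬ (IsPath tl hd (tl b) t Q ∧ b ∉ Q) → y Q = 0) ∧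
  (∀ a : A, a ≠ b → reArcFlow tl hd t b y a ≤ u a - arcFlow tl hd s t x a) ∧
  reVal tl hd t b y = arcFlow tl hd s t x b

/-- `x` is reroutable: a rerouting exists for every failing arc. -/
def Reroutable (tl hd : A → V) (s t : V) (u : A → ℝ) (x : List A → ℝ) : Prop :=
  ∀ b : A, ∃ y : List A → ℝ, IsRerouting tl hd s t u x b y

/-- `x` is strictly reroutable: a strict rerouting exists for every failing arc. -/
def StrictlyReroutable (tl hd : A → V) (s t : V) (u : A → ℝ) (x : List A → ℝ) : Prop :=
  ∀ b : A, ∃ y : List A → ℝ, IsStrictRerouting tl hd s t u x b y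

lemma walk_trunc (tl hd : A → V) {w : V} : ∀ (L : List A) (s v : V), IsWalk tl hd s v L →
    w ∈ s :: L.map hd → ∃ L', L' <+: L ∧ IsWalk tl hd s w L'
  | [], s, v, _, hw => by
    refine ⟨[], List.prefix_rfl, ?_⟩
    simp at hw
    simp [IsWalk, hw]
  | a :: L, s, v, h, hw => by
    by_cases hs : w = s
    · exact ⟨[], List.nil_prefix, by simp [IsWalk, hs]⟩
    · have hw' : w ∈ hd a :: L.map hd := by
        simpa [hs] using hw
      obtain ⟨L', h1, h2⟩ := walk_trunc tl hd L (hd a) v h.2 hw'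
      exact ⟨a :: L', by simpa using h1, h.1, h2⟩

lemma walk_snoc (tl hd : A → V) (b : A) : ∀ (L : List A) (s : V), IsWalk tl hd s (tl b) L →
    IsWalk tl hd s (hd b) (L ++ [b])
  | [], s, h => by
    simp [IsWalk] at h ⊢
    exact h.symm
  | a :: L, s, h => ⟨h.1, walk_snoc tl hd b L (hd a) h.2⟩

lemma walk_cross (tl hd : A → V) (S : V → Prop) (t : V) (ht : ¬ S t) :
    ∀ (L : List A) (s : V), IsWalk tl hd s t L → S s → ∃ a ∈ L, S (tl a) ∧ ¬ S (hd a)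
  | [], s, h, hs => by
    simp [IsWalk] at h
    subst h
    exact absurd hs ht
  | a :: L, s, h, hs => by
    by_cases hh : S (hd a)
    · obtain ⟨b, hb, h2⟩ := walk_cross tl hd S t ht L (hd a) h.2 hh
      exact ⟨b, List.mem_cons_of_mem _ hb, h2⟩
    · exact ⟨a, by simp, by rw [h.1]; exact hs, hh⟩

lemma walk_div [DecidableEq V] (tl hd : A → V) (t v : V) :
    ∀ (L : List A) (s : V), IsWalk tl hd s t L →
    (L.map fun a => ((if tl a = v then 1 else 0) - (if hd a = v then 1 else 0) : ℤ)).sum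
      = (if s = v then 1 else 0) - (if t = v then 1 else 0)
  | [], s, h => by
    simp [IsWalk] at h
    simp [h]
  | a :: L, s, h => by
    have := walk_div tl hd t v L (hd a) h.2
    simp only [List.map_cons, List.sum_cons, this, h.1]
    ring

lemma reach_or_cut (tl hd : A → V) (s t : V) (good : A → Prop) :
    (∃ L, IsPath tl hd s t L ∧ ∀ a ∈ L, good a) ∨
    ∃ S : V → Prop, S s ∧ ¬ S t ∧ ∀ a, good a → S (tl a) → S (hd a) := by
  by_cases h : ∃ L, IsPath tl hd s t L ∧ ∀ a ∈ L, good a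
  · exact Or.inl h
  · right
    refine ⟨fun v => ∃ L, IsPath tl hd s v L ∧ ∀ a ∈ L, good a,
      ⟨[], by simp [IsPath, IsWalk], by simp⟩, h, ?_⟩
    rintro a ha ⟨L, ⟨hw, hn⟩, hg⟩
    by_cases hm : hd a ∈ s :: L.map hd
    · obtain ⟨L', hp, hw'⟩ := walk_trunc tl hd L s _ hw hm
      refine ⟨L', ⟨hw', ?_⟩, fun b hb => hg b (hp.subset hb)⟩
      refine hn.sublist ?_
      exact (List.Sublist.cons_cons _ (hp.sublist.map hd))
    · refine ⟨L ++ [a], ⟨walk_snoc tl hd a L s hw, ?_⟩, ?_⟩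
      · rw [List.map_append, ← List.cons_append, List.nodup_append]
        refine ⟨hn, by simp, ?_⟩
        intro x hx y hy
        simp at hy
        subst hy
        rintro rfl
        exact hm hx
      · intro b hb
        rcases List.mem_append.1 hb with hb | hb
        · exact hg b hb
        · simp at hb; subst hb; exact ha

lemma path_nodup {tl hd : A → V} {s t : V} {L : List A} (h : IsPath tl hd s t L) : L.Nodup :=
  List.Nodup.of_map hd (List.nodup_cons.1 h.2).2

/-- Arc-based conservation. -/
def Cons [Fintype A] [DecidableEq V] (tl hd : A → V) (s t : V) (k : ℤ) (f : A → ℤ) : Prop :=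
  ∀ v, ∑ a, f a * ((if tl a = v then 1 else 0) - (if hd a = v then 1 else 0))
    = k * ((if s = v then 1 else 0) - (if t = v then 1 else 0))

open Classical in
lemma cons_cut [Fintype A] [Fintype V] (tl hd : A → V) (s t : V) (k : ℤ) (f : A → ℤ)
    (h : Cons tl hd s t k f) (S : V → Prop) (hs : S s) (ht : ¬ S t) :
    ∑ a, f a * ((if S (tl a) then 1 else 0) - (if S (hd a) then 1 else 0)) = k := by
  have h1 : ∑ v ∈ Finset.univ.filter S,
      ∑ a, f a * ((if tl a = v then 1 else 0) - (if hd a = v then 1 else 0))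
      = ∑ v ∈ Finset.univ.filter S, k * ((if s = v then 1 else 0) - (if t = v then 1 else 0)) :=
    Finset.sum_congr rfl fun v _ => h v
  rw [Finset.sum_comm] at h1
  simp only [← Finset.mul_sum, Finset.sum_sub_distrib, Finset.sum_ite_eq, Finset.mem_filter,
    Finset.mem_univ, true_and, hs, ht, if_true, if_false] at h1
  simpa using h1

lemma sum_map_eq_of_nodup [Fintype A] [DecidableEq A] (L : List A) (h : L.Nodup) (g : A → ℤ) :
    (L.map g).sum = ∑ a, (if a ∈ L then 1 else 0) * g a := by
  rw [← List.sum_toFinset g h]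
  simp [Finset.sum_ite]
  congr 1
  ext; simp

lemma cons_path [Fintype A] [DecidableEq A] [DecidableEq V] (tl hd : A → V) (s t : V) (L : List A)
    (h : IsPath tl hd s t L) : Cons tl hd s t 1 (fun a => if a ∈ L then 1 else 0) := by
  intro v
  rw [one_mul, ← walk_div tl hd t v L s h.1, sum_map_eq_of_nodup L (path_nodup h)]

open Classical in
/-- finite set of nodup lists -/
noncomputable def nl (A : Type) [Fintype A] : Finset (List A) :=
  (Finset.univ : Finset {l : List A // l.Nodup}).image Subtype.val

open Classical in
lemma sumOver_eq [Fintype A] (x : List A → ℝ) (S : Set (List A)) (hS : ∀ P ∈ S, P.Nodup) :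
    sumOver x S = ∑ P ∈ nl A, if P ∈ S then x P else 0 := by
  unfold sumOver
  rw [← Finset.sum_filter, finsum_mem_eq_finite_toFinset_sum x
    (Set.Finite.subset (nl A).finite_toSet (fun P hP => by simp [nl, hS P hP]))]
  refine Finset.sum_congr ?_ fun _ _ => rfl
  ext P
  simp [nl]
  exact fun h => hS P h

open Classical in
lemma arcFlow_eq [Fintype A] [DecidableEq A] (tl hd : A → V) (s t : V) (x : List A → ℝ) (a : A) :
    arcFlow tl hd s t x a = ∑ P ∈ nl A, if IsPath tl hd s t P ∧ a ∈ P then x P else 0 := by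
  unfold arcFlow
  rw [sumOver_eq _ {P | IsPath tl hd s t P ∧ a ∈ P} (fun P hP => path_nodup hP.1)]
  refine Finset.sum_congr rfl fun P _ => ?_
  by_cases hq : IsPath tl hd s t P ∧ a ∈ P
  · rw [if_pos hq]; exact if_pos hq
  · rw [if_neg hq]; exact if_neg hq

open Classical in
lemma flowVal_eq [Fintype A] (tl hd : A → V) (s t : V) (x : List A → ℝ) :
    flowVal tl hd s t x = ∑ P ∈ nl A, if IsPath tl hd s t P then x P else 0 := by
  unfold flowVal
  rw [sumOver_eq _ {P | IsPath tl hd s t P} (fun P hP => path_nodup (Set.mem_ofPred_eq ▸ hP))]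
  refine Finset.sum_congr rfl fun P _ => ?_
  simp only [Set.mem_ofPred_eq]

lemma sumOver_nonneg (x : List A → ℝ) (S : Set (List A)) (h : ∀ P, 0 ≤ x P) : 0 ≤ sumOver x S :=
  finsum_nonneg fun P => finsum_nonneg fun _ => h P

lemma arcFlow_smul [Fintype A] (tl hd : A → V) (s t : V) (x : List A → ℝ) (r : ℝ) (a : A) :
    arcFlow tl hd s t (fun P => r * x P) a = r * arcFlow tl hd s t x a := by
  classical
  rw [arcFlow_eq, arcFlow_eq, Finset.mul_sum]
  simp

lemma flowVal_smul [Fintype A] (tl hd : A → V) (s t : V) (x : List A → ℝ) (r : ℝ) :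
    flowVal tl hd s t (fun P => r * x P) = r * flowVal tl hd s t x := by
  classical
  rw [flowVal_eq, flowVal_eq, Finset.mul_sum]
  simp

lemma decompose [Fintype A] [Fintype V] [DecidableEq V] [DecidableEq A] (tl hd : A → V) (s t : V) :
    ∀ (k : ℕ) (f : A → ℤ), (∀ a, 0 ≤ f a) → Cons tl hd s t k f →
    ∃ z : List A → ℕ, IsFlow tl hd s t (fun a => (f a : ℝ)) (fun P => (z P : ℝ)) ∧
      flowVal tl hd s t (fun P => (z P : ℝ)) = k
  | 0, f, hf, hc => by
    refine ⟨fun _ => 0, ⟨by simp, by simp, fun a => ?_⟩, ?_⟩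
    · simp [arcFlow, sumOver, hf a]
    · simp [flowVal, sumOver]
  | k + 1, f, hf, hc => by
    classical
    rcases reach_or_cut tl hd s t (fun a => 0 < f a) with ⟨L, hL, hg⟩ | ⟨S, hs, ht, hS⟩
    · have hcp := cons_path tl hd s t L hL
      obtain ⟨z, ⟨h1, h2, h3⟩, h4⟩ := decompose tl hd s t k
        (fun a => f a - if a ∈ L then 1 else 0)
        (fun a => by
          by_cases h : a ∈ L
          · have := hg a h
            simp [h]; omega
          · simp [h, hf a])
        (fun v => by
          have e1 := hc v
          have e2 := hcp v
          simp only [sub_mul, Finset.sum_sub_distrib]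
          rw [e1, e2]; push_cast; ring)
      have hLn : L ∈ nl A := by simp [nl, path_nodup hL]
      refine ⟨fun P => z P + if P = L then 1 else 0, ⟨fun P => by positivity, fun P hP => ?_,
        fun a => ?_⟩, ?_⟩
      · have : P ≠ L := by rintro rfl; exact hP hL
        have := h2 P hP
        simp_all
      · have := h3 a
        rw [arcFlow_eq] at this ⊢
        have e : ∀ P, (if IsPath tl hd s t P ∧ a ∈ P then
            (((z P + if P = L then 1 else 0 : ℕ)) : ℝ) else 0)
            = (if IsPath tl hd s t P ∧ a ∈ P then (z P : ℝ) else 0)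
              + if P = L then (if a ∈ L then 1 else 0) else 0 := by
          intro P
          by_cases hP : P = L
          · subst hP
            by_cases haP : a ∈ P <;> simp [hL, haP]
          · simp [hP]
        simp only [e, Finset.sum_add_distrib, Finset.sum_ite_eq', hLn, if_true]
        push_cast at this
        linarith
      · rw [flowVal_eq] at h4 ⊢
        have e : ∀ P, (if IsPath tl hd s t P then
            (((z P + if P = L then 1 else 0 : ℕ)) : ℝ) else 0)
            = (if IsPath tl hd s t P then (z P : ℝ) else 0)
              + if P = L then 1 else 0 := by
          intro P
          by_cases hP : P = L
          · subst hP
            simp [hL]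
          · simp [hP]
        simp only [e, Finset.sum_add_distrib, Finset.sum_ite_eq', hLn, if_true, h4]
        push_cast; ring
    · exfalso
      have hc' : Cons tl hd s t ((k + 1 : ℕ) : ℤ) f := hc
      have := cons_cut tl hd s t ((k + 1 : ℕ) : ℤ) f (by convert hc') S hs ht
      have h2 : ∑ a, f a * ((if S (tl a) then 1 else 0) - (if S (hd a) then 1 else 0)) ≤ 0 := by
        refine Finset.sum_nonpos fun a _ => ?_
        have h0 := hf a
        by_cases h : 0 < f a
        · have := hS a h
          by_cases h1 : S (tl a)
          · simp [h1, this h1]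
          · by_cases h2 : S (hd a) <;> simp [h1, h2, h0]
        · have : f a = 0 := by omega
          simp [this]
      rw [this] at h2
      push_cast at h2
      omega

lemma augment [Fintype A] [Fintype V] [DecidableEq V] [DecidableEq A] (tl hd : A → V) (s t : V)
    (c : A → ℕ) (k : ℤ) (f : A → ℤ) (hf : ∀ a, 0 ≤ f a ∧ f a ≤ c a) (hc : Cons tl hd s t k f) :
    (∃ f' : A → ℤ, (∀ a, 0 ≤ f' a ∧ f' a ≤ c a) ∧ Cons tl hd s t (k+1) f') ∨
    ∃ S : V → Prop, S s ∧ ¬ S t ∧ (∀ a, f a < c a → S (tl a) → S (hd a)) ∧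
      (∀ a, 0 < f a → S (hd a) → S (tl a)) := by
  rcases reach_or_cut (A := A ⊕ A) (Sum.elim tl hd) (Sum.elim hd tl) s t
    (Sum.elim (fun a => f a < c a) (fun a => 0 < f a)) with ⟨L, hL, hg⟩ | ⟨S, hs, ht, hS⟩
  · left
    obtain ⟨g, hgL, hcp⟩ : ∃ g : A ⊕ A → ℤ, (∀ a, (a ∈ L ∧ g a = 1) ∨ (a ∉ L ∧ g a = 0)) ∧
        Cons (Sum.elim tl hd) (Sum.elim hd tl) s t 1 g := by
      refine ⟨_, fun a => ?_, cons_path _ _ s t L hL⟩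
      by_cases h : a ∈ L <;> simp [h]
    refine ⟨fun a => f a + g (Sum.inl a) - g (Sum.inr a),
      fun a => ?_, fun v => ?_⟩
    · have := hf a
      have g1 : Sum.inl a ∈ L → f a < c a := fun h => by simpa using hg _ h
      have g2 : Sum.inr a ∈ L → 0 < f a := fun h => by simpa using hg _ h
      dsimp only
      rcases hgL (Sum.inl a) with ⟨h1, h2⟩ | ⟨h1, h2⟩ <;>
      rcases hgL (Sum.inr a) with ⟨h3, h4⟩ | ⟨h3, h4⟩ <;> rw [h2, h4] <;> grind
    · have e1 := hc v
      have e2 := hcp v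
      rw [Fintype.sum_sum_type] at e2
      simp only [Sum.elim_inl, Sum.elim_inr] at e2
      rw [add_mul, ← e1, ← e2, ← Finset.sum_add_distrib, ← Finset.sum_add_distrib]
      refine Finset.sum_congr rfl fun a _ => ?_
      by_cases q1 : tl a = v <;> by_cases q2 : hd a = v <;> simp [q1, q2] <;> ring
  · right
    exact ⟨S, hs, ht, fun a ha h => hS (Sum.inl a) (by simpa using ha) h,
      fun a ha h => hS (Sum.inr a) (by simpa using ha) h⟩

lemma exists_max [Fintype A] [Fintype V] [DecidableEq V] [DecidableEq A] (tl hd : A → V) (s t : V)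
    (hst : s ≠ t) (c : A → ℕ) :
    ∃ (k : ℕ) (f : A → ℤ), (∀ a, 0 ≤ f a ∧ f a ≤ c a) ∧ Cons tl hd s t k f ∧
    ¬ ∃ f' : A → ℤ, (∀ a, 0 ≤ f' a ∧ f' a ≤ c a) ∧ Cons tl hd s t (k+1) f' := by
  classical
  let p : ℕ → Prop := fun k => ∃ f : A → ℤ, (∀ a, 0 ≤ f a ∧ f a ≤ c a) ∧ Cons tl hd s t k f
  have hb : ∀ k, p k → k ≤ ∑ a, c a := by
    rintro k ⟨f, hf, hc⟩
    have := hc s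
    simp [hst.symm] at this
    zify
    rw [← this]
    refine Finset.sum_le_sum fun a _ => ?_
    have := hf a
    split_ifs <;> simp <;> omega
  have h0 : p 0 := ⟨fun _ => 0, by simp, fun v => by simp⟩
  have h1 := Nat.findGreatest_spec (P := p) (Nat.zero_le (∑ a, c a)) h0
  obtain ⟨f, hf, hc⟩ := h1
  refine ⟨_, f, hf, hc, ?_⟩
  rintro ⟨f', hf', hc'⟩
  have h2 : p (Nat.findGreatest p (∑ a, c a) + 1) := ⟨f', hf', by push_cast; exact hc'⟩
  have := Nat.le_findGreatest (hb _ h2) h2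
  omega

lemma cut_bound [Fintype A] (tl hd : A → V) (s t : V) (u : A → ℝ) (y : List A → ℝ)
    (hy : IsFlow tl hd s t u y) (S : V → Prop) (hs : S s) (ht : ¬ S t) (C : Finset A)
    (hC : ∀ a, S (tl a) → ¬ S (hd a) → a ∈ C) :
    flowVal tl hd s t y ≤ ∑ a ∈ C, u a := by
  classical
  refine le_trans ?_ (Finset.sum_le_sum fun a _ => hy.2.2 a)
  simp only [arcFlow_eq]
  rw [flowVal_eq, Finset.sum_comm]
  refine Finset.sum_le_sum fun P _ => ?_
  by_cases hP : IsPath tl hd s t P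
  · obtain ⟨a, ha, h1, h2⟩ := walk_cross tl hd S t ht P s hP.1 hs
    simp only [hP, if_true, true_and]
    have := Finset.single_le_sum (f := fun a => if a ∈ P then y P else 0)
      (fun i _ => by split_ifs <;> simp [hy.1 P]) (hC a h1 h2)
    simpa [ha] using this
  · simp [hP]

theorem maxflow [Fintype A] [Fintype V] [DecidableEq V] [DecidableEq A] (tl hd : A → V) (s t : V)
    (hst : s ≠ t) (c : A → ℕ) :
    ∃ (k : ℕ) (z : List A → ℕ), IsFlow tl hd s t (fun a => (c a : ℝ)) (fun P => (z P : ℝ)) ∧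
      flowVal tl hd s t (fun P => (z P : ℝ)) = k ∧
      ∀ y, IsFlow tl hd s t (fun a => (c a : ℝ)) y → flowVal tl hd s t y ≤ k := by
  classical
  obtain ⟨k, f, hf, hc, hn⟩ := exists_max tl hd s t hst c
  obtain ⟨z, hz, hv⟩ := decompose tl hd s t k f (fun a => (hf a).1) hc
  refine ⟨k, z, ⟨hz.1, hz.2.1, fun a => (hz.2.2 a).trans ?_⟩, hv, fun y hy => ?_⟩
  · have := (hf a).2
    show (f a : ℝ) ≤ (c a : ℝ)
    exact_mod_cast this
  rcases augment tl hd s t c k f hf hc with h | ⟨S, hs, ht, h1, h2⟩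
  · exact absurd h hn
  have hcut := cons_cut tl hd s t k f (by convert hc) S hs ht
  have hb := cut_bound tl hd s t _ y hy S hs ht
    (Finset.univ.filter fun a => S (tl a) ∧ ¬ S (hd a)) (by simp; tauto)
  refine hb.trans (le_of_eq ?_)
  have : (∑ a ∈ Finset.univ.filter (fun a => S (tl a) ∧ ¬ S (hd a)), (c a : ℤ)) = k := by
    rw [← hcut, Finset.sum_filter]
    refine Finset.sum_congr rfl fun a _ => ?_
    have := hf a
    have g1 := h1 a
    have g2 := h2 a
    by_cases e1 : S (tl a) <;> by_cases e2 : S (hd a) <;> simp [e1, e2] at g1 g2 ⊢ <;> omega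
  exact_mod_cast this

lemma arc_from_t (tl hd : A → V) (t : V) (b : A) (hb : tl b = t) : ∀ (P : List A) (s : V),
    IsPath tl hd s t P → b ∉ P
  | [], s, _ => by simp
  | a :: L, s, h => by
    have h2 := arc_from_t tl hd t b hb L (hd a) ⟨h.1.2, (List.nodup_cons.1 h.2).2⟩
    have hend : ∀ (L : List A) (v : V), IsWalk tl hd v t L → t ∈ v :: L.map hd := by
      intro L
      induction L with
      | nil => intro v h; simp [IsWalk] at h; simp [h]
      | cons a L ih => intro v h; exact List.mem_cons_of_mem _ (ih _ h.2)
    have h3 := hend L (hd a) h.1.2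
    intro hm
    rcases List.mem_cons.1 hm with e | e
    · subst e
      have : s = t := h.1.1.symm.trans hb
      subst this
      exact (List.nodup_cons.1 h.2).1 h3
    · exact h2 e

lemma re_eq (tl hd : A → V) (t : V) (b : A) (y : List A → ℝ) (hy : ∀ Q, b ∈ Q → y Q = 0) :
    (∀ a, reArcFlow tl hd t b y a = arcFlow tl hd (tl b) t y a) ∧
    reVal tl hd t b y = flowVal tl hd (tl b) t y := by
  have key : ∀ S T : Set (List A), (∀ Q, b ∉ Q → (Q ∈ S ↔ Q ∈ T)) → sumOver y S = sumOver y T := by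
    intro S T h
    unfold sumOver
    rw [finsum_mem_def, finsum_mem_def]
    congr 1
    ext Q
    by_cases hQ : b ∈ Q
    · simp [Set.indicator, hy Q hQ]
    · have := h Q hQ
      classical
      simp only [Set.indicator_apply, this]
  refine ⟨fun a => key _ _ ?_, key _ _ ?_⟩
  · intro Q hQ; simp [hQ]
  · intro Q hQ; simp [hQ]

lemma arcFlow_zero (tl hd : A → V) (s t : V) (b : A) (y : List A → ℝ)
    (hy : ∀ Q, IsPath tl hd s t Q → b ∈ Q → y Q = 0) : arcFlow tl hd s t y b = 0 := by
  unfold arcFlow sumOver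
  exact finsum_mem_eq_zero_of_forall_eq_zero fun Q hQ => hy Q hQ.1 hQ.2

lemma re_bound [Fintype A] [Fintype V] [DecidableEq V] [DecidableEq A] (tl hd : A → V) (s t : V)
    (c : A → ℕ) (b : A) :
    ∃ (m : ℕ) (w : List A → ℝ), (∀ Q, 0 ≤ w Q) ∧
      (∀ Q, ¬ (IsPath tl hd (tl b) t Q ∧ b ∉ Q) → w Q = 0) ∧
      (∀ a, reArcFlow tl hd t b w a ≤ c a) ∧ reVal tl hd t b w = m ∧
      ∀ x y, (∀ P, 0 ≤ x P) → IsRerouting tl hd s t (fun a => (c a : ℝ)) x b y →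
        arcFlow tl hd s t x b ≤ m := by
  by_cases hb : tl b = t
  · refine ⟨0, fun _ => 0, by simp, by simp, by simp [reArcFlow, sumOver],
      by simp [reVal, sumOver], fun x y _ _ => ?_⟩
    rw [arcFlow_zero]
    · simp
    · intro Q hQ hbQ
      exact absurd hbQ (arc_from_t tl hd t b hb Q s hQ)
  obtain ⟨m, z, hz, hv, hmax⟩ := maxflow tl hd (tl b) t hb (Function.update c b 0)
  have hz0 : ∀ Q, b ∈ Q → (z Q : ℝ) = 0 := by
    intro Q hQ
    by_cases hp : IsPath tl hd (tl b) t Q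
    · have h := hz.2.2 b
      simp only [Function.update_self, Nat.cast_zero] at h
      classical
      rw [arcFlow_eq] at h
      have hle := Finset.single_le_sum
        (f := fun P => if IsPath tl hd (tl b) t P ∧ b ∈ P then (z P : ℝ) else 0)
        (fun i _ => by positivity) (show Q ∈ nl A by simp [nl, path_nodup hp])
      simp only [hp, hQ, and_self, if_true] at hle
      exact le_antisymm (hle.trans h) (by positivity)
    · exact hz.2.1 Q hp
  have hre := re_eq tl hd t b _ hz0
  refine ⟨m, fun P => (z P : ℝ), hz.1, ?_, ?_, hre.2.trans hv, ?_⟩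
  · intro Q hQ
    by_cases h : b ∈ Q
    · exact hz0 Q h
    · exact hz.2.1 Q fun hp => hQ ⟨hp, h⟩
  · intro a
    rw [hre.1]
    refine (hz.2.2 a).trans ?_
    by_cases h : a = b
    · subst h; simp
    · simp [h]
  · intro x y hx hy
    have hy0 : ∀ Q, b ∈ Q → y Q = 0 := fun Q hQ => hy.2.1 Q (by tauto)
    have hre' := re_eq tl hd t b y hy0
    rw [← hy.2.2.2, hre'.2]
    refine hmax y ⟨hy.1, fun Q hQ => hy.2.1 Q (by tauto), fun a => ?_⟩
    by_cases h : a = b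
    · subst h
      rw [arcFlow_zero _ _ _ _ _ _ fun Q _ => hy0 Q]
      simp
    · rw [← hre'.1]
      refine (hy.2.2.1 a h).trans ?_
      simp only [ne_eq, h, not_false_eq_true, Function.update_of_ne]
      unfold availCap
      have := sumOver_nonneg x {P | IsPath tl hd s t P ∧ a ∈ P ∧ ¬ Before P b a} hx
      linarith

/-- If the capacities are integral, there is a half-integral strictly
reroutable s-t-flow whose value is at least half the value of every reroutable s-t-flow. -/
theorem half_integral_two_approximation
    {V A : Type} [Fintype V] [DecidableEq V] [Fintype A] [DecidableEq A]
    (tl hd : A → V) (s t : V) (hst : s ≠ t) (u : A → ℝ)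
    (hu : ∀ a : A, ∃ n : ℕ, u a = (n : ℝ))
    (hcover : ∀ v : V, ∃ L : List A, IsPath tl hd s t L ∧ v ∈ s :: L.map hd) :
    ∃ x : List A → ℝ,
      IsFlow tl hd s t u x ∧
      StrictlyReroutable tl hd s t u x ∧
      (∀ P : List A, ∃ n : ℤ, 2 * x P = (n : ℝ)) ∧
      ∀ y : List A → ℝ, IsFlow tl hd s t u y → Reroutable tl hd s t u y →
        flowVal tl hd s t y / 2 ≤ flowVal tl hd s t x := by
  choose c hc using hu
  obtain rfl : u = fun a => (c a : ℝ) := funext hc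
  choose m w hw0 hwp hwc hwv hwb using re_bound tl hd s t c
  obtain ⟨k, z, hz, hv, hmax⟩ := maxflow tl hd s t hst (fun a => min (c a) (m a))
  have hzc : ∀ a, arcFlow tl hd s t (fun P => (z P : ℝ)) a ≤ c a := fun a =>
    (hz.2.2 a).trans (Nat.cast_le.2 (min_le_left (c a) (m a)))
  have hzm : ∀ a, arcFlow tl hd s t (fun P => (z P : ℝ)) a ≤ m a := fun a =>
    (hz.2.2 a).trans (Nat.cast_le.2 (min_le_right (c a) (m a)))
  have hz0 : ∀ a, 0 ≤ arcFlow tl hd s t (fun P => (z P : ℝ)) a := fun a =>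
    sumOver_nonneg _ _ hz.1
  refine ⟨fun P => (1/2) * (z P : ℝ), ⟨fun P => by positivity, fun P hP => ?_, fun a => ?_⟩,
    fun b => ?_, fun P => ⟨z P, by push_cast; ring⟩, fun y hy hr => ?_⟩
  · have := hz.2.1 P hP
    simp_all
  · rw [arcFlow_smul]
    linarith [hzc a, hz0 a]
  · set q : ℝ := (1/2) * arcFlow tl hd s t (fun P => (z P : ℝ)) b / m b with hq
    have hq0 : 0 ≤ q := by
      have := hz0 b
      positivity
    have hq1 : q ≤ 1/2 := by
      rw [hq]
      refine div_le_of_le_mul₀ (by positivity) (by norm_num) ?_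
      linarith [hzm b]
    have hqm : q * m b = (1/2) * arcFlow tl hd s t (fun P => (z P : ℝ)) b := by
      by_cases h : (m b : ℝ) = 0
      · have h1 := hzm b
        have h2 := hz0 b
        rw [h] at h1
        rw [h, le_antisymm h1 h2]; simp
      · rw [hq]; field_simp
    have hwz : ∀ Q, b ∈ Q → w b Q = 0 := fun Q hQ => hwp b Q (by tauto)
    have hwz' : ∀ Q, b ∈ Q → q * w b Q = 0 := fun Q hQ => by rw [hwz Q hQ, mul_zero]
    have r1 := re_eq tl hd t b (w b) hwz
    have r2 := re_eq tl hd t b (fun Q => q * w b Q) hwz'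
    refine ⟨fun Q => q * w b Q, fun Q => mul_nonneg hq0 (hw0 b Q),
      fun Q hQ => by simp [hwp b Q hQ], fun a _ => ?_, ?_⟩
    · rw [r2.1, arcFlow_smul, arcFlow_smul, ← r1.1]
      have h1 := hwc b a
      have h2 : 0 ≤ reArcFlow tl hd t b (w b) a := sumOver_nonneg _ _ (hw0 b)
      have h3 := mul_le_mul hq1 h1 h2 (by norm_num)
      linarith [hzc a]
    · rw [r2.2, flowVal_smul, arcFlow_smul, ← r1.2, hwv, hqm]
  · rw [flowVal_smul, hv]
    have := hmax y ⟨hy.1, hy.2.1, fun a => ?_⟩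
    · linarith
    · obtain ⟨y', hy'⟩ := hr a
      have h1 := hwb a y y' hy.1 hy'
      have h2 := hy.2.2 a
      push_cast
      exact le_min h2 h1
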